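/- Let A be a symmetric N × N matrix over the field 𝔽₂ all of whose diagonal entries equal 1. Then the all-ones vector (1, 1, …, 1) ∈ 𝔽₂^N lies in the range (column space) of A; that is, there exists x ∈ 𝔽₂^N with A x = (1, …, 1). -/

import Mathlib

/-- In characteristic two, the off-diagonal terms of a symmetric double sum cancel. -/
theorem CharTwo.sum_sum_eq_sum_diag {ι R : Type*} [Fintype ι] [Ring R] [CharP R 2]
    (g : ι → ι → R) (hg : ∀ i j, g i j = g j i) :
    ∑ i, ∑ j, g i j = ∑ i, g i i := by
  classical
  have hoff : ∑ p : ι × ι, (if p.1 = p.2 then 0 else g p.1 p.2) = 0 := by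
    refine Finset.sum_involution (fun p _ => p.swap) ?_ ?_ ?_ ?_
    · rintro ⟨i, j⟩ -
      simp [hg j i, eq_comm (a := j), CharTwo.add_self_eq_zero]
    · rintro ⟨i, j⟩ - hne heq
      simp_all
    · simp
    · simp
  have hsplit : ∀ i j, g i j = (if i = j then 0 else g i j) + if i = j then g i j else 0 := by
    intro i j
    split_ifs <;> simp
  rw [Fintype.sum_prod_type] at hoff
  calc ∑ i, ∑ j, g i j
      = ∑ i, ∑ j, ((if i = j then 0 else g i j) + if i = j then g i j else 0) :=
        Finset.sum_congr rfl fun i _ => Finset.sum_congr rfl fun j _ => hsplit i j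
    _ = ∑ i, g i i := by
        simp_rw [Finset.sum_add_distrib]
        rw [hoff]
        simp

/-- Over `ZMod 2`, the quadratic form of a symmetric matrix is the linear form given by its
diagonal. -/
theorem Matrix.IsSymm.dotProduct_mulVec_self_zmod_two {n : Type*} [Fintype n]
    {A : Matrix n n (ZMod 2)} (hA : A.IsSymm) (y : n → ZMod 2) :
    y ⬝ᵥ A.mulVec y = y ⬝ᵥ A.diag := by
  have hsq : ∀ a b : ZMod 2, a * (b * a) = a * b := by decide
  simp only [dotProduct, Matrix.mulVec, Finset.mul_sum]
  rw [CharTwo.sum_sum_eq_sum_diag]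
  · simp [hsq]
  · intro i j
    rw [hA.apply j i]
    ring

theorem all_ones_in_range (N : ℕ) (A : Matrix (Fin N) (Fin N) (ZMod 2))
    (hA : A.IsSymm) (hdiag : ∀ i, A i i = 1) :
    ∃ x : Fin N → ZMod 2, A.mulVec x = fun _ => 1 := by
  have hd : A.diag = fun _ => 1 := funext hdiag
  rw [← hd]
  change A.diag ∈ LinearMap.range A.mulVecLin
  by_contra hnot
  obtain ⟨f, hf, hker⟩ := Submodule.exists_le_ker_of_notMem hnot
  obtain ⟨y, rfl⟩ := (dotProductEquiv (ZMod 2) (Fin N)).surjective f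
  apply hf
  have hy : y ⬝ᵥ A.mulVec y = 0 := hker (LinearMap.mem_range_self A.mulVecLin y)
  rwa [hA.dotProduct_mulVec_self_zmod_two] at hy
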